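/- Let (V,X,Y,W,Z) be random variables on finite sets with joint distribution p(v,x,y,w,z) satisfying the Markov chains V − X − (Y,W,Z) and (V,X,Z) − Y − W. Then the pair of conditions {S_X(V) ∈ M(Γ(G_{X|Y,Z})) and S_Y(W) ∈ M(Γ(G_{Y|S_X(V),Z}))} holds if and only if for all v, w, z and all x₁,x₂ in the support set {x : p(v,x) > 0} of v and all y₁,y₂ in the support set {y : p(w,y) > 0} of w with p(x₁,y₁,z)·p(x₂,y₂,z) > 0, one has f(x₁,y₁,z) = f(x₂,y₂,z). -/

import Mathlib

open Finset

attribute [local instance] Classical.propDecidable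

noncomputable section

/-- Probability of an event under a probability mass function on a finite sample space. -/
def pr {Ω : Type} [Fintype Ω] (μ : Ω → ℝ) (E : Set Ω) : ℝ :=
  ∑ ω, if ω ∈ E then μ ω else 0

/-- The distribution (law) of a random variable `X` under `μ`. -/
def law {Ω 𝒜 : Type} [Fintype Ω] (μ : Ω → ℝ) (X : Ω → 𝒜) : 𝒜 → ℝ :=
  fun a => pr μ {ω | X ω = a}

/-- Shannon entropy (base 2) of a discrete random variable. -/
def ent {Ω 𝒜 : Type} [Fintype Ω] [Fintype 𝒜] (μ : Ω → ℝ) (X : Ω → 𝒜) : ℝ :=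
  -∑ a, law μ X a * Real.logb 2 (law μ X a)

/-- Conditional entropy `H(X|Y) = H(X,Y) - H(Y)`. -/
def condEnt {Ω 𝒜 ℬ : Type} [Fintype Ω] [Fintype 𝒜] [Fintype ℬ]
    (μ : Ω → ℝ) (X : Ω → 𝒜) (Y : Ω → ℬ) : ℝ :=
  ent μ (fun ω => (X ω, Y ω)) - ent μ Y

/-- Mutual information `I(X;Y)`. -/
def mutInf {Ω 𝒜 ℬ : Type} [Fintype Ω] [Fintype 𝒜] [Fintype ℬ]
    (μ : Ω → ℝ) (X : Ω → 𝒜) (Y : Ω → ℬ) : ℝ :=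
  ent μ X + ent μ Y - ent μ (fun ω => (X ω, Y ω))

/-- Conditional mutual information `I(X;Y|Z)`. -/
def condMutInf {Ω 𝒜 ℬ 𝒞 : Type} [Fintype Ω] [Fintype 𝒜] [Fintype ℬ] [Fintype 𝒞]
    (μ : Ω → ℝ) (X : Ω → 𝒜) (Y : Ω → ℬ) (Z : Ω → 𝒞) : ℝ :=
  condEnt μ X Z + condEnt μ Y Z - condEnt μ (fun ω => (X ω, Y ω)) Z

/-- Markov chain `U − V − W`: `U` and `W` are conditionally independent given `V`. -/
def MarkovChain {Ω 𝒜 ℬ 𝒞 : Type} [Fintype Ω]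
    (μ : Ω → ℝ) (U : Ω → 𝒜) (V : Ω → ℬ) (W : Ω → 𝒞) : Prop :=
  ∀ a b c, pr μ {ω | U ω = a ∧ V ω = b ∧ W ω = c} * pr μ {ω | V ω = b}
    = pr μ {ω | U ω = a ∧ V ω = b} * pr μ {ω | V ω = b ∧ W ω = c}

/-- `⌈2^{nR}⌉`, the number of messages available at blocklength `n` and rate `R`. -/
def codeSize (n : ℕ) (R : ℝ) : ℕ := Nat.ceil ((2 : ℝ) ^ ((n : ℝ) * R))

/-- The i.i.d. product mass function on sequences of length `n`. -/
def iid {𝒜 : Type} (p : 𝒜 → ℝ) (n : ℕ) : (Fin n → 𝒜) → ℝ :=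
  fun s => ∏ i, p (s i)

/-- A rate pair `(RX, RY)` is achievable for computing `f` at a receiver knowing `Z`,
from separate encodings of `X` and `Y`, when `(X,Y,Z) ~ p` i.i.d. -/
def Achievable {𝒳 𝒴 𝒵 F : Type} [Fintype 𝒳] [Fintype 𝒴] [Fintype 𝒵] [Fintype F]
    (p : 𝒳 × 𝒴 × 𝒵 → ℝ) (f : 𝒳 → 𝒴 → 𝒵 → F) (RX RY : ℝ) : Prop :=
  ∀ ε : ℝ, 0 < ε → ∃ N : ℕ, ∀ n, N ≤ n →
    ∃ (φX : (Fin n → 𝒳) → Fin (codeSize n RX))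
      (φY : (Fin n → 𝒴) → Fin (codeSize n RY))
      (ψ : Fin (codeSize n RX) → Fin (codeSize n RY) → (Fin n → 𝒵) → (Fin n → F)),
      pr (iid p n)
        {s | ψ (φX fun i => (s i).1) (φY fun i => (s i).2.1) (fun i => (s i).2.2)
            ≠ fun i => f (s i).1 (s i).2.1 (s i).2.2} ≤ ε

/-- The rate region: the closure of the set of achievable rate pairs. -/
def RateRegion {𝒳 𝒴 𝒵 F : Type} [Fintype 𝒳] [Fintype 𝒴] [Fintype 𝒵] [Fintype F]
    (p : 𝒳 × 𝒴 × 𝒵 → ℝ) (f : 𝒳 → 𝒴 → 𝒵 → F) : Set (ℝ × ℝ) :=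
  closure {r | Achievable p f r.1 r.2}

/-- Conditional characteristic graph adjacency of `A` given `C`, w.r.t. joint
weights `q` and function `g`. -/
def charAdj {𝒜 𝒞 F : Type} (q : 𝒜 → 𝒞 → ℝ) (g : 𝒜 → 𝒞 → F) (a₁ a₂ : 𝒜) : Prop :=
  a₁ ≠ a₂ ∧ ∃ c, 0 < q a₁ c * q a₂ c ∧ g a₁ c ≠ g a₂ c

/-- Adjacency of the conditional characteristic graph `G_{X|Y,Z}`. -/
def adjXgYZ {𝒳 𝒴 𝒵 F : Type} (p : 𝒳 × 𝒴 × 𝒵 → ℝ) (f : 𝒳 → 𝒴 → 𝒵 → F) : 𝒳 → 𝒳 → Prop :=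
  charAdj (fun x (c : 𝒴 × 𝒵) => p (x, c.1, c.2)) (fun x c => f x c.1 c.2)

/-- Adjacency of the conditional characteristic graph `G_{Y|X,Z}`. -/
def adjYgXZ {𝒳 𝒴 𝒵 F : Type} (p : 𝒳 × 𝒴 × 𝒵 → ℝ) (f : 𝒳 → 𝒴 → 𝒵 → F) : 𝒴 → 𝒴 → Prop :=
  charAdj (fun y (c : 𝒳 × 𝒵) => p (c.1, y, c.2)) (fun y c => f c.1 y c.2)

/-- Adjacency of the conditional characteristic graph `G_{X,Y|Z}`. -/
def adjXYgZ {𝒳 𝒴 𝒵 F : Type} (p : 𝒳 × 𝒴 × 𝒵 → ℝ) (f : 𝒳 → 𝒴 → 𝒵 → F) :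
    (𝒳 × 𝒴) → (𝒳 × 𝒴) → Prop :=
  charAdj (fun a (z : 𝒵) => p (a.1, a.2, z)) (fun a z => f a.1 a.2 z)

/-- `s` is an independent set of the graph with adjacency `adj`. -/
def IndepFinset {𝒜 : Type} (adj : 𝒜 → 𝒜 → Prop) (s : Finset 𝒜) : Prop :=
  ∀ a₁ ∈ s, ∀ a₂ ∈ s, ¬ adj a₁ a₂

/-- `s` is a maximal independent set of the graph with adjacency `adj`. -/
def MaxIndepFinset {𝒜 : Type} (adj : 𝒜 → 𝒜 → Prop) (s : Finset 𝒜) : Prop :=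
  IndepFinset adj s ∧ ∀ t, IndepFinset adj t → s ⊆ t → t = s

/-- Adjacency of the generalized conditional characteristic graph `G_{Y|V,Z}` (a graph on
the values of `Y`): `y₁ ∼ y₂` iff they are distinct and there are `v, z` with
`p(v,y₁,z)·p(v,y₂,z) > 0` on which the function `f̃_X` (computed through the hidden
variable `X`) takes different values. -/
def genAdj {Ω 𝒱 𝒳 𝒴 𝒵 F : Type} [Fintype Ω] (μ : Ω → ℝ)
    (V : Ω → 𝒱) (X : Ω → 𝒳) (Y : Ω → 𝒴) (Z : Ω → 𝒵) (f : 𝒳 → 𝒴 → 𝒵 → F)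
    (y₁ y₂ : 𝒴) : Prop :=
  y₁ ≠ y₂ ∧ ∃ v z x₁ x₂,
    0 < pr μ {ω | V ω = v ∧ X ω = x₁ ∧ Y ω = y₁ ∧ Z ω = z} ∧
    0 < pr μ {ω | V ω = v ∧ X ω = x₂ ∧ Y ω = y₂ ∧ Z ω = z} ∧
    f x₁ y₁ z ≠ f x₂ y₂ z

/-- Conditional graph entropy `H_G(A|C)`: the infimum of `I(V;A|C)` over all joint
distributions `μ` of `(V,A,C)` whose `(A,C)`-marginal is `q`, satisfying the Markov
chain `V − A − C` with `A ∈ V ∈ Γ*(G)`. -/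
def condGraphEnt {𝒜 𝒞 : Type} [Fintype 𝒜] [Fintype 𝒞]
    (adj : 𝒜 → 𝒜 → Prop) (q : 𝒜 × 𝒞 → ℝ) : ℝ :=
  sInf { r : ℝ | ∃ μ : Finset 𝒜 × 𝒜 × 𝒞 → ℝ,
    (∀ a, 0 ≤ μ a) ∧ (∑ a, μ a = 1) ∧
    (∀ x c, (∑ v, μ (v, x, c)) = q (x, c)) ∧
    MarkovChain μ (fun a => a.1) (fun a => a.2.1) (fun a => a.2.2) ∧
    (∀ v x c, 0 < μ (v, x, c) → x ∈ v) ∧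
    (∀ v x c, 0 < μ (v, x, c) → MaxIndepFinset adj v) ∧
    r = condMutInf μ (fun a => a.1) (fun a => a.2.1) (fun a => a.2.2) }

/-- The support set `{x : p(v,x) > 0}` attached to an index `v` of `V`. -/
def suppSet {Ω 𝒱 𝒜 : Type} [Fintype Ω] [Fintype 𝒜] (μ : Ω → ℝ)
    (V : Ω → 𝒱) (X : Ω → 𝒜) (v : 𝒱) : Finset 𝒜 :=
  Finset.univ.filter (fun x => 0 < pr μ {ω | V ω = v ∧ X ω = x})

/-- The support-set random variable `S_X(V) = (V, {x : p(V,x) > 0})`. -/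
def suppVar {Ω 𝒱 𝒜 : Type} [Fintype Ω] [Fintype 𝒜] (μ : Ω → ℝ)
    (V : Ω → 𝒱) (X : Ω → 𝒜) : Ω → 𝒱 × Finset 𝒜 :=
  fun ω => (V ω, suppSet μ V X (V ω))

theorem pr_nonneg {Ω : Type} [Fintype Ω] {μ : Ω → ℝ} (hμ : ∀ ω, 0 ≤ μ ω) (E : Set Ω) :
    0 ≤ pr μ E :=
  Finset.sum_nonneg fun ω _ => by split_ifs <;> simp [hμ ω]

theorem pr_pos_iff {Ω : Type} [Fintype Ω] {μ : Ω → ℝ} (hμ : ∀ ω, 0 ≤ μ ω) (E : Set Ω) :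
    0 < pr μ E ↔ ∃ ω ∈ E, 0 < μ ω := by
  unfold pr
  rw [Finset.sum_pos_iff_of_nonneg fun ω _ => by split_ifs <;> simp [hμ ω]]
  refine exists_congr fun ω => ?_
  by_cases h : ω ∈ E <;> simp [h]

theorem pr_mul_pr_pos_iff {Ω : Type} [Fintype Ω] {μ : Ω → ℝ} (hμ : ∀ ω, 0 ≤ μ ω)
    (E E' : Set Ω) : 0 < pr μ E * pr μ E' ↔ 0 < pr μ E ∧ 0 < pr μ E' := by
  refine ⟨fun h => ⟨?_, ?_⟩, fun h => mul_pos h.1 h.2⟩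
  · exact pos_of_mul_pos_left h (pr_nonneg hμ E')
  · exact pos_of_mul_pos_right h (pr_nonneg hμ E)

/-- Along a Markov chain `U − V − W`, positivity of `p(a,b)` and `p(b,c)` forces positivity
of `p(a,b,c)`. -/
theorem MarkovChain.pr_pos {Ω 𝒜 ℬ 𝒞 : Type} [Fintype Ω] {μ : Ω → ℝ} (hμ : ∀ ω, 0 ≤ μ ω)
    {U : Ω → 𝒜} {V : Ω → ℬ} {W : Ω → 𝒞} (h : MarkovChain μ U V W) {a : 𝒜} {b : ℬ} {c : 𝒞}
    (hab : 0 < pr μ {ω | U ω = a ∧ V ω = b}) (hbc : 0 < pr μ {ω | V ω = b ∧ W ω = c}) :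
    0 < pr μ {ω | U ω = a ∧ V ω = b ∧ W ω = c} := by
  have hpos := mul_pos hab hbc
  rw [← h a b c] at hpos
  exact ((pr_mul_pr_pos_iff hμ _ _).1 hpos).1

/-- Lemma 3, claim d: for `(V,X,Y,W,Z) ~ p` on the canonical sample space
satisfying the Markov chains `V − X − (Y,W,Z)` and `(V,X,Z) − Y − W`, the conditions
{`S_X(V) ∈ M(Γ(G_{X|Y,Z}))` and `S_Y(W) ∈ M(Γ(G_{Y|S_X(V),Z}))`} hold iff for all
`v, w, z`, all `x₁, x₂` in the support set of `v` and all `y₁, y₂` in the support set of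
`w` with `p(x₁,y₁,z)·p(x₂,y₂,z) > 0`, one has `f(x₁,y₁,z) = f(x₂,y₂,z)`. -/
theorem support_sets_indep_iff_support_condition
    (𝒱 𝒳 𝒴 𝒲 𝒵 F : Type)
    [Fintype 𝒱] [Fintype 𝒳] [Fintype 𝒴] [Fintype 𝒲] [Fintype 𝒵] [Fintype F]
    (p : 𝒱 × 𝒳 × 𝒴 × 𝒲 × 𝒵 → ℝ) (hp0 : ∀ a, 0 ≤ p a) (hp1 : ∑ a, p a = 1)
    (f : 𝒳 → 𝒴 → 𝒵 → F)
    (hMk1 : MarkovChain p (fun a => a.1) (fun a => a.2.1)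
      (fun a => (a.2.2.1, a.2.2.2.1, a.2.2.2.2)))
    (hMk2 : MarkovChain p (fun a => (a.1, a.2.1, a.2.2.2.2)) (fun a => a.2.2.1)
      (fun a => a.2.2.2.1)) :
    ((∀ v, IndepFinset
        (adjXgYZ (law p (fun a => (a.2.1, a.2.2.1, a.2.2.2.2))) f)
        (suppSet p (fun a => a.1) (fun a => a.2.1) v)) ∧
      (∀ w, IndepFinset
        (genAdj p (suppVar p (fun a => a.1) (fun a => a.2.1))
          (fun a => a.2.1) (fun a => a.2.2.1) (fun a => a.2.2.2.2) f)
        (suppSet p (fun a => a.2.2.2.1) (fun a => a.2.2.1) w)))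
    ↔
      ∀ (v : 𝒱) (w : 𝒲) (z : 𝒵) (x₁ x₂ : 𝒳) (y₁ y₂ : 𝒴),
        x₁ ∈ suppSet p (fun a => a.1) (fun a => a.2.1) v →
        x₂ ∈ suppSet p (fun a => a.1) (fun a => a.2.1) v →
        y₁ ∈ suppSet p (fun a => a.2.2.2.1) (fun a => a.2.2.1) w →
        y₂ ∈ suppSet p (fun a => a.2.2.2.1) (fun a => a.2.2.1) w →
        0 < law p (fun a => (a.2.1, a.2.2.1, a.2.2.2.2)) (x₁, y₁, z)
            * law p (fun a => (a.2.1, a.2.2.1, a.2.2.2.2)) (x₂, y₂, z) →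
        f x₁ y₁ z = f x₂ y₂ z := by
  have key : ∀ v x y z,
      0 < pr p {ω | ω.1 = v ∧ ω.2.1 = x} →
      0 < pr p {ω | (ω.2.1, ω.2.2.1, ω.2.2.2.2) = (x, y, z)} →
      ∃ w, 0 < p (v, x, y, w, z) := by
    intro v x y z hv hl
    obtain ⟨⟨v', x', y', w, z'⟩, hm, hpos⟩ := (pr_pos_iff hp0 _).1 hl
    simp only [Set.mem_ofPred_eq, Prod.mk.injEq] at hm
    obtain ⟨rfl, rfl, rfl⟩ := hm
    have hxc : 0 < pr p {ω | ω.2.1 = x' ∧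
        (ω.2.2.1, ω.2.2.2.1, ω.2.2.2.2) = (y', w, z')} :=
      (pr_pos_iff hp0 _).2 ⟨_, ⟨rfl, rfl⟩, hpos⟩
    obtain ⟨⟨v₁, x₁, y₁, w₁, z₁⟩, hm, hpos₁⟩ :=
      (pr_pos_iff hp0 _).1 (hMk1.pr_pos hp0 hv hxc)
    simp only [Set.mem_ofPred_eq, Prod.mk.injEq] at hm
    obtain ⟨rfl, rfl, rfl, rfl, rfl⟩ := hm
    exact ⟨_, hpos₁⟩
  simp only [law, pr_mul_pr_pos_iff hp0, suppSet, Finset.mem_filter, Finset.mem_univ, true_and]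
  constructor
  · rintro ⟨hX, hY⟩ v w z x₁ x₂ y₁ y₂ hx₁ hx₂ hy₁ hy₂ ⟨hl₁, hl₂⟩
    by_contra hne
    by_cases hy : y₁ = y₂
    · subst hy
      refine hX v x₁ (by simpa using hx₁) x₂ (by simpa using hx₂)
        ⟨fun h => hne (h ▸ rfl), (y₁, z), ?_, hne⟩
      exact mul_pos hl₁ hl₂
    · obtain ⟨w₁, h₁⟩ := key v x₁ y₁ z hx₁ hl₁
      obtain ⟨w₂, h₂⟩ := key v x₂ y₂ z hx₂ hl₂
      refine hY w y₁ (by simpa using hy₁) y₂ (by simpa using hy₂)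
        ⟨hy, (v, suppSet p (fun a => a.1) (fun a => a.2.1) v), z, x₁, x₂,
          (pr_pos_iff hp0 _).2 ⟨(v, x₁, y₁, w₁, z), ⟨rfl, rfl, rfl, rfl⟩, h₁⟩,
          (pr_pos_iff hp0 _).2 ⟨(v, x₂, y₂, w₂, z), ⟨rfl, rfl, rfl, rfl⟩, h₂⟩, hne⟩
  · intro h
    constructor
    · rintro v x₁ hx₁ x₂ hx₂ ⟨-, ⟨y, z⟩, hpos, hne⟩
      simp only [Finset.mem_filter, Finset.mem_univ, true_and] at hx₁ hx₂
      have hl := (pr_mul_pr_pos_iff hp0 _ _).1 hpos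
      obtain ⟨w, hw⟩ := key v x₁ y z hx₁ hl.1
      have hy : 0 < pr p {ω | ω.2.2.2.1 = w ∧ ω.2.2.1 = y} :=
        (pr_pos_iff hp0 _).2 ⟨_, ⟨rfl, rfl⟩, hw⟩
      exact hne (h v w z x₁ x₂ y y hx₁ hx₂ hy hy hl)
    · rintro w y₁ hy₁ y₂ hy₂ ⟨-, ⟨v, s⟩, z, x₁, x₂, hpos₁, hpos₂, hne⟩
      simp only [Finset.mem_filter, Finset.mem_univ, true_and] at hy₁ hy₂
      have marg : ∀ x y, 0 < pr p {ω | suppVar p (fun a => a.1) (fun a => a.2.1) ω = (v, s) ∧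
          ω.2.1 = x ∧ ω.2.2.1 = y ∧ ω.2.2.2.2 = z} →
          0 < pr p {ω | ω.1 = v ∧ ω.2.1 = x} ∧
          0 < pr p {ω | (ω.2.1, ω.2.2.1, ω.2.2.2.2) = (x, y, z)} := by
        intro x y hpos
        obtain ⟨ω, ⟨hv, rfl, rfl, rfl⟩, hω⟩ := (pr_pos_iff hp0 _).1 hpos
        exact ⟨(pr_pos_iff hp0 _).2 ⟨ω, ⟨congrArg Prod.fst hv, rfl⟩, hω⟩,
          (pr_pos_iff hp0 _).2 ⟨ω, rfl, hω⟩⟩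
      obtain ⟨hx₁, hl₁⟩ := marg x₁ y₁ hpos₁
      obtain ⟨hx₂, hl₂⟩ := marg x₂ y₂ hpos₂
      exact hne (h v w z x₁ x₂ y₁ y₂ hx₁ hx₂ hy₁ hy₂ ⟨hl₁, hl₂⟩)
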